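/- Let K ≥ 2 be an integer, let α satisfy Condition A, and let γ > 0 be such that the Cauchy measure Cauchy(γ) is invariant under the SGB map S_{K,α}. Then the dynamical system (ℝ, S_{K,α}, Cauchy(γ)) is ergodic: S_{K,α} is measure-preserving for Cauchy(γ), and every Borel set A with S_{K,α}⁻¹(A) = A (up to Cauchy(γ)-null sets) has Cauchy(γ)-measure 0 or 1. -/

import Mathlib

open MeasureTheory Real

/-- The cotangent function `cot t = cos t / sin t`. -/
noncomputable def cot' (t : ℝ) : ℝ := Real.cos t / Real.sin t

/-- `arccot x = π/2 - arctan x ∈ (0, π)`. -/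
noncomputable def arccot' (x : ℝ) : ℝ := Real.pi / 2 - Real.arctan x

/-- The Super Generalized Boole (SGB) map `S_{K,α}(x) = α K cot(K arccot x)`. -/
noncomputable def SGB (K : ℕ) (α : ℝ) (x : ℝ) : ℝ := α * K * cot' (K * arccot' x)

/-- The Cauchy probability measure with scale parameter `γ`. -/
noncomputable def cauchyMeasure (γ : ℝ) : Measure ℝ :=
  MeasureTheory.volume.withDensity (fun x => ENNReal.ofReal (γ / (Real.pi * (x ^ 2 + γ ^ 2))))

open scoped ComplexConjugate

/-- The Cayley transform of the upper half-plane onto the unit disc that sends `c * I` to `0`. -/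
noncomputable def cayley (c : ℝ) (z : ℂ) : ℂ := (z - c * Complex.I) / (z + c * Complex.I)

/-- The density of the harmonic measure of the upper half-plane seen from `z`. -/
noncomputable def poissonDensity (z : ℂ) (x : ℝ) : ℝ :=
  z.im / (Real.pi * ((x - z.re) ^ 2 + z.im ^ 2))

/-- The harmonic measure of the upper half-plane seen from `z`, that is, the Cauchy distribution
with location `z.re` and scale `z.im`. -/
noncomputable def poissonMeasure (z : ℂ) : Measure ℝ :=
  volume.withDensity fun x => ENNReal.ofReal (poissonDensity z x)

/-- The quantity `1 - d ^ 2`, where `d` is the pseudo-hyperbolic distance in the upper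
half-plane. -/
noncomputable def proximity (z w : ℂ) : ℝ := 4 * z.im * w.im / Complex.normSq (z - conj w)

lemma add_mul_I_ne_zero {c : ℝ} (hc : 0 < c) {z : ℂ} (hz : 0 ≤ z.im) : z + c * Complex.I ≠ 0 := by
  intro h
  have := congrArg Complex.im h
  simp at this
  linarith

lemma ofReal_add_mul_I_ne_zero {c : ℝ} (hc : 0 < c) (x : ℝ) : (x : ℂ) + c * Complex.I ≠ 0 :=
  add_mul_I_ne_zero hc (by simp)

lemma sub_conj_ne_zero {z w : ℂ} (hz : 0 < z.im) (hw : 0 < w.im) : z - conj w ≠ 0 := by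
  intro h
  have := congrArg Complex.im h
  simp at this
  linarith

lemma one_sub_normSq_cayley {c : ℝ} (hc : 0 < c) {z : ℂ} (hz : 0 ≤ z.im) :
    1 - Complex.normSq (cayley c z) = 4 * c * z.im / Complex.normSq (z + c * Complex.I) := by
  have h := Complex.normSq_pos.2 (add_mul_I_ne_zero hc hz)
  rw [cayley, Complex.normSq_div, eq_div_iff h.ne', sub_mul, div_mul_cancel₀ _ h.ne']
  simp [Complex.normSq_apply]
  ring

lemma normSq_cayley_lt_one {c : ℝ} (hc : 0 < c) {z : ℂ} (hz : 0 < z.im) :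
    Complex.normSq (cayley c z) < 1 := by
  have h := Complex.normSq_pos.2 (add_mul_I_ne_zero hc hz.le)
  have := one_sub_normSq_cayley hc hz.le
  have : 0 < 4 * c * z.im / Complex.normSq (z + c * Complex.I) := by positivity
  linarith

lemma normSq_cayley_ofReal {c : ℝ} (hc : 0 < c) (x : ℝ) : Complex.normSq (cayley c x) = 1 := by
  have := one_sub_normSq_cayley hc (z := (x : ℂ)) (by simp)
  simp at this
  linarith

lemma norm_cayley_ofReal {c : ℝ} (hc : 0 < c) (x : ℝ) : ‖cayley c x‖ = 1 := by
  have := normSq_cayley_ofReal hc x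
  rw [Complex.normSq_eq_norm_sq] at this
  exact (pow_eq_one_iff_of_nonneg (norm_nonneg _) two_ne_zero).1 this

lemma cayley_inj {c : ℝ} (hc : 0 < c) {z w : ℂ} (hz : 0 ≤ z.im) (hw : 0 ≤ w.im)
    (h : cayley c z = cayley c w) : z = w := by
  have hz' := add_mul_I_ne_zero hc hz
  have hw' := add_mul_I_ne_zero hc hw
  rw [cayley, cayley, div_eq_div_iff hz' hw'] at h
  have hc' : (2 * c * Complex.I : ℂ) ≠ 0 := by
    simp [hc.ne', Complex.I_ne_zero]
  refine mul_left_cancel₀ hc' ?_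
  linear_combination h

lemma exists_cayley_eq {c : ℝ} (hc : 0 < c) {w : ℂ} (hw : Complex.normSq w < 1) :
    ∃ z : ℂ, 0 < z.im ∧ cayley c z = w := by
  have hw1 : 1 - w ≠ 0 := by
    intro h
    rw [← sub_eq_zero.1 h] at hw
    simp at hw
  refine ⟨c * Complex.I * (1 + w) / (1 - w), ?_, ?_⟩
  · have h := Complex.normSq_pos.2 hw1
    have : (c * Complex.I * (1 + w) / (1 - w)).im
        = c * (1 - Complex.normSq w) / Complex.normSq (1 - w) := by
      rw [Complex.div_im]
      simp [Complex.normSq_apply] at h ⊢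
      field_simp
      ring
    rw [this]
    have : 0 < 1 - Complex.normSq w := by linarith
    positivity
  · have hc' : (c : ℂ) ≠ 0 := by exact_mod_cast hc.ne'
    have e1 : c * Complex.I * (1 + w) / (1 - w) - c * Complex.I
        = (2 * c * Complex.I) * w / (1 - w) := by field_simp; ring
    have e2 : c * Complex.I * (1 + w) / (1 - w) + c * Complex.I
        = (2 * c * Complex.I) / (1 - w) := by field_simp; ring
    rw [cayley, e1, e2]
    field_simp

lemma proximity_eq_cayley {c : ℝ} (hc : 0 < c) {z w : ℂ} (hz : 0 < z.im) (hw : 0 < w.im) :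
    proximity z w = (1 - Complex.normSq (cayley c z)) * (1 - Complex.normSq (cayley c w)) /
      Complex.normSq (1 - conj (cayley c w) * cayley c z) := by
  have hz' := add_mul_I_ne_zero hc hz.le
  have hw' := add_mul_I_ne_zero hc hw.le
  have hw'' : conj w - c * Complex.I ≠ 0 := by
    have := (map_ne_zero (starRingEnd ℂ)).2 hw'
    simpa [sub_eq_add_neg] using this
  have key : 1 - conj (cayley c w) * cayley c z
      = (-(2 * c * Complex.I)) * (z - conj w) / ((z + c * Complex.I) * (conj w - c * Complex.I)) := by
    rw [cayley, cayley]
    simp only [map_div₀, map_sub, map_add, map_mul, Complex.conj_ofReal, Complex.conj_I,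
      mul_neg, sub_neg_eq_add, ← sub_eq_add_neg]
    field_simp
    ring
  have hcc : Complex.normSq (conj w - c * Complex.I) = Complex.normSq (w + c * Complex.I) := by
    rw [← Complex.normSq_conj]; simp
  rw [one_sub_normSq_cayley hc hz.le, one_sub_normSq_cayley hc hw.le, key, Complex.normSq_div,
    Complex.normSq_mul, Complex.normSq_mul, hcc, proximity]
  have h1 := (Complex.normSq_pos.2 hz').ne'
  have h2 := (Complex.normSq_pos.2 hw').ne'
  have h3 := (Complex.normSq_pos.2 (sub_conj_ne_zero hz hw)).ne'
  have h4 : Complex.normSq (-(2 * c * Complex.I)) = 4 * c ^ 2 := by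
    simp [Complex.normSq_apply]; ring
  rw [h4]
  field_simp

lemma normSq_geom_sum_lt {w v : ℂ} (hwv : w ≠ v) {K : ℕ} (hK : 2 ≤ K) :
    Complex.normSq (∑ j ∈ Finset.range K, (conj v * w) ^ j) <
      (∑ j ∈ Finset.range K, Complex.normSq w ^ j) *
        ∑ j ∈ Finset.range K, Complex.normSq v ^ j := by
  induction K, hK using Nat.le_induction with
  | base =>
    have := Complex.normSq_pos.2 (sub_ne_zero.2 hwv)
    simp [Finset.sum_range_succ, Complex.normSq_apply] at this ⊢
    nlinarith
  | succ n _ ih =>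
    rw [Finset.sum_range_succ, Finset.sum_range_succ, Finset.sum_range_succ]
    set T := ∑ j ∈ Finset.range n, (conj v * w) ^ j
    set A := ∑ j ∈ Finset.range n, Complex.normSq w ^ j
    set B := ∑ j ∈ Finset.range n, Complex.normSq v ^ j
    have hA : 0 ≤ A := Finset.sum_nonneg fun j _ => pow_nonneg (Complex.normSq_nonneg _) _
    have hB : 0 ≤ B := Finset.sum_nonneg fun j _ => pow_nonneg (Complex.normSq_nonneg _) _
    have ha : 0 ≤ Complex.normSq w ^ n := pow_nonneg (Complex.normSq_nonneg _) _
    have hb : 0 ≤ Complex.normSq v ^ n := pow_nonneg (Complex.normSq_nonneg _) _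
    have ht : ‖(conj v * w) ^ n‖ ^ 2 = Complex.normSq w ^ n * Complex.normSq v ^ n := by
      rw [← Complex.normSq_eq_norm_sq, map_pow, map_mul, Complex.normSq_conj, mul_pow, mul_comm]
    rw [Complex.normSq_eq_norm_sq] at ih ⊢
    have htri := norm_add_le T ((conj v * w) ^ n)
    set τ := ‖(conj v * w) ^ n‖
    set a := Complex.normSq w ^ n
    set b := Complex.normSq v ^ n
    have hcross : 2 * (‖T‖ * τ) ≤ A * b + B * a := by
      refine abs_le_of_sq_le_sq' ?_ (by positivity) |>.2
      have : ‖T‖ ^ 2 * τ ^ 2 ≤ A * B * (a * b) := by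
        rw [ht]; gcongr
      nlinarith [sq_nonneg (A * b - B * a)]
    have hsq : ‖T + (conj v * w) ^ n‖ ^ 2 ≤ (‖T‖ + τ) ^ 2 := by gcongr
    nlinarith

lemma proximity_lt_of_cayley_eq_pow {b c : ℝ} (hb : 0 < b) (hc : 0 < c) {K : ℕ} (hK : 2 ≤ K)
    {z w z' w' : ℂ} (hz : 0 < z.im) (hw : 0 < w.im) (hz' : 0 < z'.im) (hw' : 0 < w'.im)
    (hzz : cayley c z' = cayley b z ^ K) (hww : cayley c w' = cayley b w ^ K) (hne : z ≠ w) :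
    proximity z w < proximity z' w' := by
  rw [proximity_eq_cayley hb hz hw, proximity_eq_cayley hc hz' hw', hzz, hww]
  have hne' : cayley b z ≠ cayley b w := fun h => hne (cayley_inj hb hz.le hw.le h)
  have h1 := normSq_cayley_lt_one hb hz
  have h2 := normSq_cayley_lt_one hb hw
  have h1' := normSq_cayley_lt_one hc hz'
  have h2' := normSq_cayley_lt_one hc hw'
  rw [hzz] at h1'
  rw [hww] at h2'
  set s := cayley b z
  set t := cayley b w
  have hden {s t : ℂ} (hs : Complex.normSq s < 1) (ht : Complex.normSq t < 1) :
      1 - conj t * s ≠ 0 := by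
    intro h
    have : Complex.normSq (conj t * s) = 1 := by rw [← sub_eq_zero.1 h]; simp
    rw [map_mul, Complex.normSq_conj] at this
    nlinarith [Complex.normSq_nonneg s, Complex.normSq_nonneg t]
  have hd := Complex.normSq_pos.2 (hden h1 h2)
  have hd' := Complex.normSq_pos.2 (hden h1' h2')
  have hlt := normSq_geom_sum_lt hne' hK
  rw [map_pow (starRingEnd ℂ), ← mul_pow] at hd' ⊢
  rw [map_pow, map_pow, ← mul_neg_geom_sum, ← mul_neg_geom_sum, ← mul_neg_geom_sum, map_mul]
  rw [← mul_neg_geom_sum, map_mul] at hd'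
  have hT := pos_of_mul_pos_right hd' hd.le
  rw [div_lt_div_iff₀ hd (mul_pos hd hT)]
  have hpos : 0 < (1 - Complex.normSq s) * (1 - Complex.normSq t) *
      Complex.normSq (1 - conj t * s) :=
    mul_pos (mul_pos (by linarith) (by linarith)) hd
  nlinarith [mul_lt_mul_of_pos_left hlt hpos]

lemma continuous_cayley_ofReal {c : ℝ} (hc : 0 < c) : Continuous fun x : ℝ => cayley c x := by
  unfold cayley
  exact Continuous.div (by fun_prop) (by fun_prop) (ofReal_add_mul_I_ne_zero hc)

lemma poissonDensity_pos {z : ℂ} (hz : 0 < z.im) (x : ℝ) : 0 < poissonDensity z x := by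
  unfold poissonDensity
  have := Real.pi_pos
  positivity

lemma continuous_poissonDensity {z : ℂ} (hz : 0 < z.im) : Continuous (poissonDensity z) := by
  unfold poissonDensity
  refine Continuous.div (by fun_prop) (by fun_prop) fun x => ?_
  have := Real.pi_pos
  positivity

lemma circleMap_two_mul_arctan (s : ℝ) :
    circleMap 0 1 (2 * Real.arctan s + Real.pi) = (s - Complex.I) / (s + Complex.I) := by
  have h : (s : ℂ) + Complex.I ≠ 0 := by
    simpa using ofReal_add_mul_I_ne_zero one_pos s
  have hs : (1 + (s : ℂ) ^ 2) ≠ 0 := by exact_mod_cast (by positivity : (1 + s ^ 2) ≠ 0)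
  have hsq : Complex.exp (Real.arctan s * Complex.I) ^ 2
      = (1 + s * Complex.I) ^ 2 / (1 + s ^ 2) := by
    rw [Complex.exp_mul_I, ← Complex.ofReal_cos, ← Complex.ofReal_sin, Real.cos_arctan,
      Real.sin_arctan]
    have hr : ((√(1 + s ^ 2) : ℝ) : ℂ) ^ 2 = 1 + s ^ 2 := by
      rw [← Complex.ofReal_pow, Real.sq_sqrt (by positivity)]
      push_cast
      ring
    rw [← hr]
    have : ((√(1 + s ^ 2) : ℝ) : ℂ) ≠ 0 := fun h0 => hs (by rw [← hr, h0]; simp)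
    push_cast
    field_simp
  have : circleMap 0 1 (2 * Real.arctan s + Real.pi)
      = Complex.exp (Real.arctan s * Complex.I) ^ 2 * Complex.exp (Real.pi * Complex.I) := by
    rw [circleMap, ← Complex.exp_nat_mul, ← Complex.exp_add]
    rw [zero_add, Complex.ofReal_one, one_mul]
    congr 1
    push_cast
    ring
  rw [this, hsq, Complex.exp_pi_mul_I, div_mul_eq_mul_div, div_eq_div_iff hs h]
  linear_combination (-2 * (s : ℂ) - s ^ 3 - s ^ 2 * Complex.I) * Complex.I_sq

lemma image_two_mul_arctan {b : ℝ} (hb : 0 < b) (a : ℝ) :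
    (fun x : ℝ => 2 * Real.arctan ((x - a) / b) + Real.pi) '' Set.univ
      = Set.Ioo 0 (2 * Real.pi) := by
  ext t
  constructor
  · rintro ⟨x, -, rfl⟩
    have h1 := Real.neg_pi_div_two_lt_arctan ((x - a) / b)
    have h2 := Real.arctan_lt_pi_div_two ((x - a) / b)
    constructor <;> dsimp only <;> linarith
  · rintro ⟨h1, h2⟩
    refine ⟨a + b * Real.tan ((t - Real.pi) / 2), trivial, ?_⟩
    dsimp only
    rw [add_sub_cancel_left, mul_div_cancel_left₀ _ hb.ne',
      Real.arctan_tan (by linarith) (by linarith)]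
    ring

/-- The harmonic measure of the upper half-plane is the image of the uniform measure on the unit
circle. -/
lemma integral_poissonDensity_smul {z : ℂ} (hz : 0 < z.im) (g : ℂ → ℂ) :
    ∫ x : ℝ, poissonDensity z x • g ((x - z) / (x - conj z)) = Real.circleAverage g 0 1 := by
  have hder : ∀ x ∈ (Set.univ : Set ℝ), HasDerivWithinAt
      (fun x : ℝ => 2 * Real.arctan ((x - z.re) / z.im) + Real.pi)
      (2 * Real.pi * poissonDensity z x) Set.univ x := by
    intro x _
    have h0 : HasDerivAt (fun x : ℝ => (x - z.re) / z.im) (1 / z.im) x :=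
      ((hasDerivAt_id x).sub_const z.re).div_const z.im
    have h1 := ((h0.arctan.const_mul 2).add_const Real.pi).hasDerivWithinAt (s := Set.univ)
    convert! h1 using 1
    unfold poissonDensity
    have := Real.pi_pos
    field_simp
    ring
  have hinj : Set.InjOn (fun x : ℝ => 2 * Real.arctan ((x - z.re) / z.im) + Real.pi)
      Set.univ := by
    intro x _ y _ hxy
    have := Real.arctan_injective (by dsimp only at hxy; linarith :
      Real.arctan ((x - z.re) / z.im) = Real.arctan ((y - z.re) / z.im))
    field_simp at this
    linarith
  have key := integral_image_eq_integral_abs_deriv_smul MeasurableSet.univ hder hinj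
    (fun t => g (circleMap 0 1 t))
  rw [image_two_mul_arctan hz, setIntegral_univ] at key
  rw [Real.circleAverage_def, intervalIntegral.integral_of_le (by positivity),
    integral_Ioc_eq_integral_Ioo, key, ← integral_smul]
  refine integral_congr_ae (Filter.Eventually.of_forall fun x => ?_)
  dsimp only
  have hp := poissonDensity_pos hz x
  have hmap : circleMap 0 1 (2 * Real.arctan ((x - z.re) / z.im) + Real.pi)
      = (x - z) / (x - conj z) := by
    rw [circleMap_two_mul_arctan]
    have h1 : (x : ℂ) - z = z.im * (((x - z.re) / z.im : ℝ) - Complex.I) := by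
      have : (z.im : ℂ) ≠ 0 := by exact_mod_cast hz.ne'
      push_cast
      field_simp
      nth_rewrite 1 [← Complex.re_add_im z]
      ring
    have h2 : (x : ℂ) - conj z = z.im * (((x - z.re) / z.im : ℝ) + Complex.I) := by
      have : (z.im : ℂ) ≠ 0 := by exact_mod_cast hz.ne'
      push_cast
      field_simp
      rw [show conj z = z.re - z.im * Complex.I by apply Complex.ext <;> simp]
      ring
    rw [h1, h2, mul_div_mul_left]
    exact_mod_cast hz.ne'
  rw [hmap, abs_of_pos (by positivity), smul_smul]
  congr 1
  field_simp

lemma integral_poissonDensity_smul_cayley_pow {c : ℝ} (hc : 0 < c) {z : ℂ} (hz : 0 < z.im)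
    (n : ℕ) : ∫ x : ℝ, poissonDensity z x • cayley c x ^ n = cayley c z ^ n := by
  set g : ℂ → ℂ := fun w => (((z - c * Complex.I) - (conj z - c * Complex.I) * w) /
    ((z + c * Complex.I) - (conj z + c * Complex.I) * w)) ^ n with hg
  have hden : ∀ w ∈ Metric.closedBall (0 : ℂ) 1,
      (z + c * Complex.I) - (conj z + c * Complex.I) * w ≠ 0 := by
    intro w hw h
    have hw1 : Complex.normSq w ≤ 1 := by
      rw [Complex.normSq_eq_norm_sq]
      simpa using hw
    have h1 := congrArg Complex.normSq (sub_eq_zero.1 h)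
    rw [map_mul] at h1
    have h2 : Complex.normSq (conj z + c * Complex.I) < Complex.normSq (z + c * Complex.I) := by
      simp [Complex.normSq_apply]
      nlinarith
    nlinarith [Complex.normSq_nonneg (conj z + c * Complex.I), Complex.normSq_nonneg w]
  have hdiff : DiffContOnCl ℂ g (Metric.ball 0 |1|) := by
    refine DifferentiableOn.diffContOnCl ?_
    rw [abs_one, closure_ball _ one_ne_zero]
    exact (DifferentiableOn.div (by fun_prop) (by fun_prop) hden).pow n
  have havg := hdiff.circleAverage
  rw [← integral_poissonDensity_smul hz] at havg
  rw [show cayley c z ^ n = g 0 by simp [hg, cayley], ← havg]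
  refine integral_congr_ae (Filter.Eventually.of_forall fun x => ?_)
  dsimp only [hg]
  congr 2
  have hx : (x : ℂ) - conj z ≠ 0 := sub_ne_zero.2 fun h => by
    have := congrArg Complex.im h
    simp at this
    linarith
  have hzz : z - conj z ≠ 0 := sub_conj_ne_zero hz hz
  have e1 : (z - c * Complex.I) - (conj z - c * Complex.I) * ((x - z) / (x - conj z))
      = (z - conj z) * (x - c * Complex.I) / (x - conj z) := by
    field_simp
    ring
  have e2 : (z + c * Complex.I) - (conj z + c * Complex.I) * ((x - z) / (x - conj z))
      = (z - conj z) * (x + c * Complex.I) / (x - conj z) := by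
    field_simp
    ring
  rw [e1, e2, div_div_div_cancel_right₀ hx, mul_div_mul_left _ _ hzz, cayley]

lemma integrable_poissonDensity {z : ℂ} (hz : 0 < z.im) : Integrable (poissonDensity z) := by
  have h := integral_poissonDensity_smul_cayley_pow one_pos hz 0
  simp only [pow_zero, Complex.real_smul, mul_one] at h
  rw [integral_complex_ofReal] at h
  by_contra hn
  rw [integral_undef hn] at h
  simp at h

lemma integral_poissonDensity {z : ℂ} (hz : 0 < z.im) : ∫ x, poissonDensity z x = 1 := by
  have h := integral_poissonDensity_smul_cayley_pow one_pos hz 0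
  simp only [pow_zero, Complex.real_smul, mul_one] at h
  rw [integral_complex_ofReal] at h
  exact_mod_cast h

lemma isProbabilityMeasure_poissonMeasure {z : ℂ} (hz : 0 < z.im) :
    IsProbabilityMeasure (poissonMeasure z) := by
  refine ⟨?_⟩
  rw [poissonMeasure, withDensity_apply _ MeasurableSet.univ, Measure.restrict_univ,
    ← ofReal_integral_eq_lintegral_ofReal (integrable_poissonDensity hz)
      (Filter.Eventually.of_forall fun x => (poissonDensity_pos hz x).le),
    integral_poissonDensity hz, ENNReal.ofReal_one]

lemma integral_poissonMeasure {E : Type*} [NormedAddCommGroup E] [NormedSpace ℝ E] {z : ℂ}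
    (hz : 0 < z.im) (f : ℝ → E) :
    ∫ x, f x ∂poissonMeasure z = ∫ x, poissonDensity z x • f x := by
  rw [poissonMeasure, integral_withDensity_eq_integral_toReal_smul
    (continuous_poissonDensity hz).measurable.ennreal_ofReal (by simp)]
  simp [ENNReal.toReal_ofReal (poissonDensity_pos hz _).le]

lemma integral_cayley_pow {c : ℝ} (hc : 0 < c) {z : ℂ} (hz : 0 < z.im) (n : ℕ) :
    ∫ x, cayley c x ^ n ∂poissonMeasure z = cayley c z ^ n := by
  rw [integral_poissonMeasure hz, integral_poissonDensity_smul_cayley_pow hc hz]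

/-- Finite measures on the line are determined by their Cayley moments. -/
lemma ext_of_integral_cayley_pow {c : ℝ} (hc : 0 < c) {μ ν : Measure ℝ} [IsFiniteMeasure μ]
    [IsFiniteMeasure ν]
    (h : ∀ n : ℕ, ∫ x, cayley c x ^ n ∂μ = ∫ x, cayley c x ^ n ∂ν) : μ = ν := by
  set u : BoundedContinuousFunction ℝ ℂ := BoundedContinuousFunction.ofNormedAddCommGroup
    (fun x => cayley c x) (continuous_cayley_ofReal hc) 1
    fun x => (norm_cayley_ofReal hc x).le with hu
  have hmul : u * star u = 1 := by
    ext x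
    simp [hu, Complex.mul_conj, normSq_cayley_ofReal hc]
  have hclosure : ∀ g ∈ Submonoid.closure ({u} ∪ star {u} : Set (BoundedContinuousFunction ℝ ℂ)),
      ∃ n : ℕ, g = u ^ n ∨ g = star u ^ n := by
    intro g hg
    induction hg using Submonoid.closure_induction_right with
    | one => exact ⟨0, by simp⟩
    | mul_right g _ y hy ih =>
      obtain ⟨n, hn⟩ := ih
      rw [Set.star_singleton, Set.mem_union, Set.mem_singleton_iff, Set.mem_singleton_iff] at hy
      rcases hn with rfl | rfl <;> rcases hy with rfl | rfl
      · exact ⟨n + 1, Or.inl (pow_succ _ _).symm⟩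
      · rcases n with _ | n
        · exact ⟨1, by simp⟩
        · exact ⟨n, Or.inl (by rw [pow_succ, mul_assoc, hmul, mul_one])⟩
      · rcases n with _ | n
        · exact ⟨1, by simp⟩
        · exact ⟨n, Or.inr (by rw [pow_succ, mul_assoc, mul_comm _ u, hmul, mul_one])⟩
      · exact ⟨n + 1, Or.inr (pow_succ _ _).symm⟩
  refine ext_of_forall_mem_subalgebra_integral_eq_of_pseudoEMetric_complete_countable
    (𝕜 := ℂ) (A := StarAlgebra.adjoin ℂ {u}) ?_ ?_
  · intro x y hxy
    refine ⟨fun x => cayley c x, ⟨u.toContinuousMap, ?_, rfl⟩, fun hxy' => hxy ?_⟩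
    · exact ⟨u, StarAlgebra.self_mem_adjoin_singleton ℂ u, rfl⟩
    · exact Complex.ofReal_injective (cayley_inj hc (by simp) (by simp) hxy')
  · intro g hg
    have hg' : g ∈ Submodule.span ℂ
        (Submonoid.closure ({u} ∪ star {u}) : Set (BoundedContinuousFunction ℝ ℂ)) := by
      rw [← Algebra.adjoin_eq_span, ← StarAlgebra.adjoin_toSubalgebra]
      exact hg
    clear hg
    induction hg' using Submodule.span_induction with
    | mem g hg =>
      obtain ⟨n, rfl | rfl⟩ := hclosure g hg
      · simpa [hu] using h n
      · have := congrArg conj (h n)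
        rw [← integral_conj, ← integral_conj] at this
        simpa [hu] using this
    | zero => simp
    | add f g _ _ hf hg =>
      simp only [BoundedContinuousFunction.coe_add, Pi.add_apply]
      rw [integral_add (f.integrable _) (g.integrable _),
        integral_add (f.integrable _) (g.integrable _)]
      exact congrArg₂ _ hf hg
    | smul a g _ hg =>
      simp only [BoundedContinuousFunction.coe_smul, integral_smul]
      exact congrArg _ hg

lemma measurable_SGB (K : ℕ) (α : ℝ) : Measurable (SGB K α) := by
  unfold SGB cot' arccot'
  fun_prop

lemma cayley_mul_cot' {c : ℝ} (hc : c ≠ 0) {t : ℝ} (ht : Real.sin t ≠ 0) :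
    cayley c ((c * cot' t : ℝ) : ℂ) = Complex.exp (-(2 * t * Complex.I)) := by
  have hs : (Real.sin t : ℂ) ≠ 0 := by exact_mod_cast ht
  have hc' : (c : ℂ) ≠ 0 := by exact_mod_cast hc
  have e1 : Complex.exp (t * Complex.I) = Real.cos t + Real.sin t * Complex.I := by
    rw [Complex.exp_mul_I, Complex.ofReal_cos, Complex.ofReal_sin]
  have e2 : Complex.exp (-(t * Complex.I)) = Real.cos t - Real.sin t * Complex.I := by
    rw [← neg_mul, Complex.exp_mul_I, Complex.cos_neg, Complex.sin_neg, Complex.ofReal_cos,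
      Complex.ofReal_sin]
    ring
  have e3 : Complex.exp (-(2 * t * Complex.I))
      = Complex.exp (-(t * Complex.I)) / Complex.exp (t * Complex.I) := by
    rw [← Complex.exp_sub]
    congr 1
    ring
  have n1 : ((c * cot' t : ℝ) : ℂ) - c * Complex.I
      = c / Real.sin t * Complex.exp (-(t * Complex.I)) := by
    rw [e2, cot', Complex.ofReal_mul, Complex.ofReal_div]
    field_simp
  have n2 : ((c * cot' t : ℝ) : ℂ) + c * Complex.I
      = c / Real.sin t * Complex.exp (t * Complex.I) := by
    rw [e1, cot', Complex.ofReal_mul, Complex.ofReal_div]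
    field_simp
  rw [cayley, n1, n2, mul_div_mul_left _ _ (div_ne_zero hc' hs), e3]

lemma sin_arccot'_ne_zero (x : ℝ) : Real.sin (arccot' x) ≠ 0 := by
  rw [arccot', Real.sin_pi_div_two_sub]
  exact (Real.cos_arctan_pos x).ne'

lemma cot'_arccot' (x : ℝ) : cot' (arccot' x) = x := by
  rw [cot', arccot', Real.sin_pi_div_two_sub, Real.cos_pi_div_two_sub, ← Real.tan_eq_sin_div_cos,
    Real.tan_arctan]

lemma cayley_SGB {K : ℕ} {α : ℝ} (hc : α * K ≠ 0) {x : ℝ} (hx : Real.sin (K * arccot' x) ≠ 0) :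
    cayley (α * K) (SGB K α x) = cayley 1 x ^ K := by
  have h := cayley_mul_cot' one_ne_zero (sin_arccot'_ne_zero x)
  rw [cot'_arccot', one_mul] at h
  rw [SGB, h, cayley_mul_cot' hc hx,
    ← Complex.exp_nat_mul]
  congr 1
  push_cast
  ring

lemma ae_sin_mul_arccot'_ne_zero {K : ℕ} (hK : K ≠ 0) :
    ∀ᵐ x : ℝ, Real.sin (K * arccot' x) ≠ 0 := by
  rw [ae_iff]
  refine Set.Countable.measure_zero ?_ _
  refine (Set.countable_range fun m : ℤ => cot' (m * Real.pi / K)).mono fun x hx => ?_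
  simp only [ne_eq, not_not, Set.mem_ofPred_eq] at hx
  obtain ⟨m, hm⟩ := Real.sin_eq_zero_iff.1 hx
  refine ⟨m, ?_⟩
  have hK' : (K : ℝ) ≠ 0 := by exact_mod_cast hK
  dsimp only
  rw [hm, mul_div_cancel_left₀ _ hK', cot'_arccot']

lemma poissonMeasure_absolutelyContinuous (z : ℂ) : poissonMeasure z ≪ volume :=
  withDensity_absolutelyContinuous _ _

lemma absolutelyContinuous_poissonMeasure {z : ℂ} (hz : 0 < z.im) : volume ≪ poissonMeasure z := by
  refine withDensity_absolutelyContinuous'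
    (continuous_poissonDensity hz).measurable.ennreal_ofReal.aemeasurable ?_
  exact Filter.Eventually.of_forall fun x => by simpa using poissonDensity_pos hz x

lemma integral_cayley_pow_map_SGB {K : ℕ} (hK : K ≠ 0) {α : ℝ} (hα : 0 < α) {z : ℂ}
    (hz : 0 < z.im) (n : ℕ) :
    ∫ x, cayley (α * K) x ^ n ∂(poissonMeasure z).map (SGB K α) = (cayley 1 z ^ K) ^ n := by
  have hc : 0 < α * K := by positivity
  rw [integral_map (measurable_SGB K α).aemeasurable
    (by exact ((continuous_cayley_ofReal hc).pow n).aestronglyMeasurable), ← pow_mul,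
    ← integral_cayley_pow one_pos hz]
  refine integral_congr_ae ?_
  filter_upwards [(poissonMeasure_absolutelyContinuous z).ae_le (ae_sin_mul_arccot'_ne_zero hK)]
    with x hx
  rw [cayley_SGB hc.ne' hx, pow_mul]

/-- The SGB map is an inner function: it maps harmonic measures of the upper
half-plane to harmonic measures. -/
lemma map_SGB_poissonMeasure {K : ℕ} (hK : K ≠ 0) {α : ℝ} (hα : 0 < α) {z z' : ℂ}
    (hz : 0 < z.im) (hz' : 0 < z'.im) (h : cayley (α * K) z' = cayley 1 z ^ K) :
    (poissonMeasure z).map (SGB K α) = poissonMeasure z' := by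
  have := isProbabilityMeasure_poissonMeasure hz
  have := isProbabilityMeasure_poissonMeasure hz'
  have hc : 0 < α * K := by positivity
  refine ext_of_integral_cayley_pow hc fun n => ?_
  rw [integral_cayley_pow_map_SGB hK hα hz, integral_cayley_pow hc hz', h]

lemma poissonDensity_le {z : ℂ} (hz : 0 < z.im) (x : ℝ) :
    poissonDensity z x ≤ (2 * z.im + (2 * z.re ^ 2 + 1) / z.im) * poissonDensity Complex.I x := by
  have hpi := Real.pi_pos
  have h1 : 0 < (x - z.re) ^ 2 + z.im ^ 2 := by positivity
  have key : x ^ 2 + 1 ≤ (2 + (2 * z.re ^ 2 + 1) / z.im ^ 2) * ((x - z.re) ^ 2 + z.im ^ 2) := by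
    have e : (2 * z.re ^ 2 + 1) / z.im ^ 2 * z.im ^ 2 = 2 * z.re ^ 2 + 1 := by field_simp
    have : 0 ≤ (2 * z.re ^ 2 + 1) / z.im ^ 2 * (x - z.re) ^ 2 := by positivity
    nlinarith [sq_nonneg (x - 2 * z.re), sq_nonneg z.im]
  have e2 : 2 * z.im + (2 * z.re ^ 2 + 1) / z.im
      = z.im * (2 + (2 * z.re ^ 2 + 1) / z.im ^ 2) := by field_simp
  simp only [poissonDensity, Complex.I_im, Complex.I_re, sub_zero, one_pow]
  rw [e2, ← mul_div_assoc, mul_one, div_le_div_iff₀ (by positivity) (by positivity)]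
  have := mul_le_mul_of_nonneg_left key (mul_pos hz hpi).le
  nlinarith

lemma continuousOn_poissonMeasure_real {A : Set ℝ} (hA : MeasurableSet A) :
    ContinuousOn (fun z => (poissonMeasure z).real A) {z | 0 < z.im} := by
  have heq : ∀ z ∈ {z : ℂ | 0 < z.im}, (poissonMeasure z).real A
      = ∫ x in A, poissonDensity z x := by
    intro z hz
    rw [← integral_indicator_one hA, integral_poissonMeasure hz, ← integral_indicator hA]
    refine integral_congr_ae (Filter.Eventually.of_forall fun x => ?_)
    by_cases hx : x ∈ A <;> simp [hx]
  refine ContinuousOn.congr (fun z₀ hz₀ => ContinuousAt.continuousWithinAt ?_) heq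
  have hz₀' : 0 < z₀.im := hz₀
  have hbound : ContinuousAt (fun z : ℂ => 2 * z.im + (2 * z.re ^ 2 + 1) / z.im) z₀ := by
    refine ContinuousAt.add (by fun_prop) (ContinuousAt.div (by fun_prop) (by fun_prop) hz₀'.ne')
  have hopen : ∀ᶠ z : ℂ in nhds z₀, 0 < z.im :=
    (isOpen_lt continuous_const Complex.continuous_im).mem_nhds hz₀
  refine continuousAt_of_dominated (bound := fun x =>
    (2 * z₀.im + (2 * z₀.re ^ 2 + 1) / z₀.im + 1) * poissonDensity Complex.I x) ?_ ?_ ?_ ?_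
  · filter_upwards [hopen] with z hz
    exact (continuous_poissonDensity hz).aestronglyMeasurable
  · filter_upwards [hopen, hbound.eventually_lt continuousAt_const (lt_add_one _)] with z hz hlt
    refine Filter.Eventually.of_forall fun x => ?_
    rw [Real.norm_of_nonneg (poissonDensity_pos hz x).le]
    refine (poissonDensity_le hz x).trans ?_
    have := poissonDensity_pos (z := Complex.I) (by simp) x
    gcongr
  · exact ((integrable_poissonDensity (by simp)).const_mul _).integrableOn
  · refine Filter.Eventually.of_forall fun x => ?_
    unfold poissonDensity
    refine ContinuousAt.div (by fun_prop) (by fun_prop) ?_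
    have := Real.pi_pos
    positivity

/-- A continuous function on the upper half-plane takes the value `h w` at every point if each of
its level sets contains, with every point other than `w`, a point closer to `w`. -/
lemma eq_of_forall_exists_proximity_lt {h : ℂ → ℝ} (hh : ContinuousOn h {z | 0 < z.im}) {w : ℂ}
    (hw : 0 < w.im)
    (hG : ∀ z : ℂ, 0 < z.im → z ≠ w →
      ∃ z' : ℂ, 0 < z'.im ∧ h z' = h z ∧ proximity z w < proximity z' w)
    {z : ℂ} (hz : 0 < z.im) : h z = h w := by
  set e := proximity z w with he
  have hnum {z : ℂ} (hz : 0 < z.im) := Complex.normSq_pos.2 (sub_conj_ne_zero hz hw)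
  have hepos : 0 < e := by
    have := hnum hz
    rw [he, proximity]
    positivity
  set C : Set ℂ := {z' | e * Complex.normSq (z' - conj w) ≤ 4 * z'.im * w.im} with hC
  have hCclosed : IsClosed C :=
    isClosed_le (continuous_const.mul (Complex.continuous_normSq.comp (by fun_prop)))
      (by fun_prop)
  have hCim : C ⊆ {z' | 0 < z'.im} := by
    intro z' hz'
    have hz'' : e * Complex.normSq (z' - conj w) ≤ 4 * z'.im * w.im := hz'
    have h0 : 0 ≤ z'.im := by
      have := mul_nonneg hepos.le (Complex.normSq_nonneg (z' - conj w))
      by_contra hneg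
      nlinarith
    refine lt_of_le_of_ne h0 fun h0 => ?_
    rw [← h0] at hz''
    have hpos : 0 < Complex.normSq (z' - conj w) := by
      rw [Complex.normSq_pos]
      intro hzero
      have := congrArg Complex.im hzero
      simp at this
      linarith
    nlinarith
  have hCbdd : C ⊆ Metric.closedBall (conj w) (4 * w.im / e) := by
    intro z' hz'
    have hz'' : e * Complex.normSq (z' - conj w) ≤ 4 * z'.im * w.im := hz'
    have him : z'.im ≤ ‖z' - conj w‖ := by
      have := Complex.im_le_norm (z' - conj w)
      simp at this
      linarith
    have him0 : 0 < z'.im := hCim hz'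
    rw [Complex.normSq_eq_norm_sq] at hz''
    rw [mem_closedBall_iff_norm, le_div_iff₀ hepos]
    have hpos : 0 < ‖z' - conj w‖ := him0.trans_le him
    refine le_of_mul_le_mul_right ?_ hpos
    nlinarith
  have hCcompact : IsCompact C := (isCompact_closedBall _ _).of_isClosed_subset hCclosed hCbdd
  have hmem {z' : ℂ} (hz' : 0 < z'.im) : z' ∈ C ↔ e ≤ proximity z' w := by
    rw [proximity, le_div_iff₀ (hnum hz')]
    rfl
  have hDclosed : IsClosed (C ∩ h ⁻¹' {h z}) :=
    (hh.mono hCim).preimage_isClosed_of_isClosed hCclosed isClosed_singleton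
  have hDcompact := hCcompact.of_isClosed_subset hDclosed Set.inter_subset_left
  have hprox : ContinuousOn (fun z' => proximity z' w) (C ∩ h ⁻¹' {h z}) := by
    unfold proximity
    refine ContinuousOn.div (by fun_prop)
      (Complex.continuous_normSq.comp (by fun_prop)).continuousOn fun z' hz' => ?_
    exact (hnum (hCim hz'.1)).ne'
  obtain ⟨z', hz', hmax⟩ := hDcompact.exists_isMaxOn ⟨z, (hmem hz).2 le_rfl, rfl⟩ hprox
  have hz'im : 0 < z'.im := hCim hz'.1
  have hval : h z' = h z := hz'.2
  by_cases hzw : z' = w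
  · rw [← hval, hzw]
  · obtain ⟨y, hy, hyval, hlt⟩ := hG z' hz'im hzw
    have hyD : y ∈ C ∩ h ⁻¹' {h z} :=
      ⟨(hmem hy).2 (((hmem hz'im).1 hz'.1).trans hlt.le), hyval.trans hval⟩
    exact absurd (hmax hyD) (not_le.2 hlt)

lemma integral_poissonDensity_I_mul_comp {y : ℝ} (hy : 0 < y) (x : ℝ) (g : ℝ → ℝ) :
    ∫ t, poissonDensity Complex.I t * g (x + y * t) =
      ∫ s, poissonDensity ⟨x, y⟩ s * g s := by
  have hdens : ∀ t, poissonDensity Complex.I t * g (x + y * t)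
      = y * (poissonDensity ⟨x, y⟩ (x + y * t) * g (x + y * t)) := by
    intro t
    have : poissonDensity Complex.I t = y * poissonDensity ⟨x, y⟩ (x + y * t) := by
      have hpi := Real.pi_pos
      simp only [poissonDensity, Complex.I_im, Complex.I_re, add_sub_cancel_left, sub_zero]
      field_simp
    rw [this, mul_assoc]
  simp_rw [hdens]
  rw [integral_const_mul, Measure.integral_comp_mul_left
    (fun s => poissonDensity ⟨x, y⟩ (x + s) * g (x + s)) y,
    integral_add_left_eq_self (fun s => poissonDensity ⟨x, y⟩ s * g s) x,
    abs_of_pos (inv_pos.2 hy), smul_eq_mul, mul_inv_cancel_left₀ (ne_of_gt hy)]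

/-- A set whose harmonic measure does not depend on the base point has an almost everywhere
constant indicator function. -/
lemma ae_indicator_eq_of_poissonMeasure_real_eq {A : Set ℝ} (hA : MeasurableSet A) {c : ℝ}
    (hc : ∀ z : ℂ, 0 < z.im → (poissonMeasure z).real A = c) :
    ∀ᵐ x : ℝ, A.indicator (1 : ℝ → ℝ) x = c := by
  set g : ℝ → ℝ := A.indicator 1 with hg
  have hgm : Measurable g := measurable_one.indicator hA
  have hgb : ∀ x, ‖g x‖ ≤ 1 := fun x => by
    by_cases hx : x ∈ A <;> simp [hg, hx]
  have hgloc : LocallyIntegrable g := by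
    refine (locallyIntegrable_const (1 : ℝ)).mono hgm.aestronglyMeasurable
      (Filter.Eventually.of_forall fun x => ?_)
    simpa using hgb x
  have hpI : 0 < Complex.I.im := by simp
  have hmean : ∀ x y : ℝ, 0 < y → ∫ t, poissonDensity Complex.I t * g (x + y * t) = c := by
    intro x y hy
    rw [integral_poissonDensity_I_mul_comp hy, ← hc ⟨x, y⟩ hy, ← integral_indicator_one hA,
      integral_poissonMeasure hy]
    rfl
  refine ae_eq_of_integral_contDiff_smul_eq hgloc (locallyIntegrable_const c)
    fun h hsmooth hsupp => ?_
  have hcont := hsmooth.continuous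
  have hint : Integrable h := hcont.integrable_of_hasCompactSupport hsupp
  set H : ℝ → ℝ := fun r => ∫ x, h x * g (x + r) with hH
  have hHcont : Continuous H := by
    have hsupp' : HasCompactSupport fun x => h (-x) := hsupp.comp_homeomorph (Homeomorph.neg ℝ)
    have hconv := hsupp'.continuous_convolution_right (ContinuousLinearMap.mul ℝ ℝ) hgloc
      (hcont.comp continuous_neg)
    convert hconv using 1
    ext r
    rw [convolution_def, hH]
    dsimp only
    rw [← integral_sub_right_eq_self _ r]
    refine integral_congr_ae (Filter.Eventually.of_forall fun s => ?_)
    simp [mul_comm]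
  have hHbound : ∀ r, ‖H r‖ ≤ ∫ x, ‖h x‖ := by
    intro r
    refine norm_integral_le_of_norm_le hint.norm (Filter.Eventually.of_forall fun x => ?_)
    rw [norm_mul]
    exact mul_le_of_le_one_right (norm_nonneg _) (hgb _)
  set Φ : ℝ → ℝ := fun y => ∫ t, poissonDensity Complex.I t * H (y * t) with hΦ
  have hΦcont : Continuous Φ := by
    refine continuous_of_dominated (bound := fun t => poissonDensity Complex.I t * ∫ x, ‖h x‖)
      (fun y => ?_) (fun y => Filter.Eventually.of_forall fun t => ?_)
      ((integrable_poissonDensity hpI).mul_const _) (Filter.Eventually.of_forall fun t => ?_)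
    · exact ((continuous_poissonDensity hpI).mul
        (hHcont.comp (by fun_prop))).aestronglyMeasurable
    · have := poissonDensity_pos hpI t
      rw [norm_mul, Real.norm_of_nonneg this.le]
      gcongr
      exact hHbound _
    · exact continuous_const.mul (hHcont.comp (by fun_prop))
  have hΦpos : ∀ y, 0 < y → Φ y = ∫ x, h x * c := by
    intro y hy
    have hprod : Integrable (fun p : ℝ × ℝ =>
        poissonDensity Complex.I p.1 * (h p.2 * g (p.2 + y * p.1))) (volume.prod volume) := by
      have h1 : Integrable (fun p : ℝ × ℝ => poissonDensity Complex.I p.1 * h p.2)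
          (volume.prod volume) := (integrable_poissonDensity hpI).mul_prod hint
      have h2 := h1.mul_bdd (c := 1) (g := fun p : ℝ × ℝ => g (p.2 + y * p.1))
        (hgm.comp (by fun_prop)).aestronglyMeasurable (Filter.Eventually.of_forall fun p => hgb _)
      simpa only [mul_assoc] using h2
    calc Φ y = ∫ t, ∫ x, poissonDensity Complex.I t * (h x * g (x + y * t)) := by
          simp only [hΦ, hH, integral_const_mul]
      _ = ∫ x, ∫ t, poissonDensity Complex.I t * (h x * g (x + y * t)) :=
          integral_integral_swap hprod
      _ = ∫ x, h x * c := by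
          refine integral_congr_ae (Filter.Eventually.of_forall fun x => ?_)
          dsimp only
          rw [← hmean x y hy, ← integral_const_mul]
          refine integral_congr_ae (Filter.Eventually.of_forall fun t => ?_)
          dsimp only
          ring
  have hlim : Filter.Tendsto Φ (nhdsWithin 0 (Set.Ioi 0)) (nhds (Φ 0)) :=
    (hΦcont.tendsto 0).mono_left nhdsWithin_le_nhds
  have hlim' : Filter.Tendsto Φ (nhdsWithin 0 (Set.Ioi 0)) (nhds (∫ x, h x * c)) := by
    refine tendsto_const_nhds.congr' ?_
    filter_upwards [self_mem_nhdsWithin] with y hy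
    exact (hΦpos y hy).symm
  have h0 : Φ 0 = ∫ x, h x * g x := by
    simp [hΦ, hH, integral_mul_const, integral_poissonDensity hpI]
  simp only [smul_eq_mul]
  rw [← h0]
  exact tendsto_nhds_unique hlim hlim'

lemma cauchyMeasure_eq_poissonMeasure (γ : ℝ) :
    cauchyMeasure γ = poissonMeasure (γ * Complex.I) := by
  simp [cauchyMeasure, poissonMeasure, poissonDensity]

lemma cayley_eq_pow_of_map_SGB_eq {K : ℕ} (hK : K ≠ 0) {α : ℝ} (hα : 0 < α) {w : ℂ}
    (hw : 0 < w.im) (h : (poissonMeasure w).map (SGB K α) = poissonMeasure w) :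
    cayley (α * K) w = cayley 1 w ^ K := by
  have h1 := integral_cayley_pow_map_SGB hK hα hw 1
  rw [h, integral_cayley_pow (by positivity) hw] at h1
  simpa using h1

/-- The harmonic measure of an invariant set does not depend on the base point. -/
lemma poissonMeasure_real_eq_of_invariant {K : ℕ} (hK : 2 ≤ K) {α : ℝ} (hα : 0 < α) {w : ℂ}
    (hw : 0 < w.im) (hinv : (poissonMeasure w).map (SGB K α) = poissonMeasure w)
    {A : Set ℝ} (hA : MeasurableSet A) (hinvA : SGB K α ⁻¹' A =ᵐ[poissonMeasure w] A) {z : ℂ}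
    (hz : 0 < z.im) : (poissonMeasure z).real A = (poissonMeasure w).real A := by
  have hK0 : K ≠ 0 := by omega
  have hc : 0 < α * K := by positivity
  refine eq_of_forall_exists_proximity_lt (h := fun z => (poissonMeasure z).real A)
    (continuousOn_poissonMeasure_real hA) hw (fun z hz hne => ?_) hz
  have hlt : Complex.normSq (cayley 1 z ^ K) < 1 := by
    rw [map_pow]
    exact pow_lt_one₀ (Complex.normSq_nonneg _) (normSq_cayley_lt_one one_pos hz) hK0
  obtain ⟨z', hz', hzz'⟩ := exists_cayley_eq hc hlt
  refine ⟨z', hz', ?_, proximity_lt_of_cayley_eq_pow one_pos hc hK hz hw hz' hw hzz'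
    (cayley_eq_pow_of_map_SGB_eq hK0 hα hw hinv) hne⟩
  have hac : poissonMeasure z ≪ poissonMeasure w :=
    (poissonMeasure_absolutelyContinuous z).trans (absolutelyContinuous_poissonMeasure hw)
  rw [← map_SGB_poissonMeasure hK0 hα hz hz' hzz', map_measureReal_apply (measurable_SGB K α) hA]
  exact measureReal_congr (hac.ae_le hinvA)

/-- Under Condition A, the SGB map with its invariant Cauchy measure is ergodic:
it is measure-preserving, and every Borel set which is invariant up to null sets
has measure `0` or `1`. -/
theorem sgb_ergodic (K : ℕ) (hK : 2 ≤ K) (α : ℝ)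
    (hA : (Even K ∧ 0 < α ∧ α < 1) ∨ (Odd K ∧ 1 / (K : ℝ) ^ 2 < α ∧ α < 1))
    (γ : ℝ) (hγ : 0 < γ)
    (hinv : Measure.map (SGB K α) (cauchyMeasure γ) = cauchyMeasure γ) :
    MeasurePreserving (SGB K α) (cauchyMeasure γ) (cauchyMeasure γ) ∧
    ∀ A : Set ℝ, MeasurableSet A →
      cauchyMeasure γ (symmDiff ((SGB K α) ⁻¹' A) A) = 0 →
      cauchyMeasure γ A = 0 ∨ cauchyMeasure γ A = 1 := by
  have hα : 0 < α := by
    rcases hA with ⟨-, h, -⟩ | ⟨-, h, -⟩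
    · exact h
    · exact lt_of_le_of_lt (by positivity) h
  refine ⟨⟨measurable_SGB K α, hinv⟩, fun A hAm hsymm => ?_⟩
  rw [cauchyMeasure_eq_poissonMeasure] at hinv hsymm ⊢
  have hw : 0 < (γ * Complex.I).im := by simpa using hγ
  have := isProbabilityMeasure_poissonMeasure hw
  have hac := poissonMeasure_absolutelyContinuous (γ * Complex.I)
  have hind := ae_indicator_eq_of_poissonMeasure_real_eq hAm fun z hz =>
    poissonMeasure_real_eq_of_invariant hK hα hw hinv hAm
      (measure_symmDiff_eq_zero_iff.1 hsymm) hz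
  by_cases hc : (poissonMeasure (γ * Complex.I)).real A = 0
  · left
    rwa [measureReal_eq_zero_iff] at hc
  · right
    rw [← mem_ae_iff_prob_eq_one hAm]
    filter_upwards [hac.ae_le hind] with x hx
    by_contra hxA
    exact hc (by rw [← hx, Set.indicator_of_notMem hxA])
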